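/- arXiv:1204.1874 — 4 statements merged into one kernel-verified Lean document; each statement's English description precedes it below -/
import Mathlib

section
/- (Unique solvability of the implicit Euler step) Let f : ℝ^n → ℝ^n be continuous and satisfy the one-sided Lipschitz condition with constant L > 0: ⟨x − y, f(x) − f(y)⟩ ≤ L‖x − y‖² for all x, y ∈ ℝ^n. Let θ ∈ (0,1] and Δt > 0 with θΔt < 1/L. Then the map F(x) := x − θ f(x) Δt is a bijection of ℝ^n onto ℝ^n; equivalently, for every b ∈ ℝ^n there exists a unique X ∈ ℝ^n with X = b + θ f(X) Δt. -/
open scoped RealInnerProductSpace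

noncomputable section

lemma finite_minty {E : Type*} [NormedAddCommGroup E] [InnerProductSpace ℝ E]
    (G : E → E) (hG : ∀ x y, 0 ≤ ⟪x - y, G x - G y⟫) (s : Finset E) (hs : s.Nonempty) :
    ∃ x ∈ convexHull ℝ (s : Set E), ∀ y ∈ s, 0 ≤ ⟪G y, y - x⟫ := by
  classical
  by_contra hcon
  push Not at hcon
  let Φ : E → (s → ℝ) := fun x i => ⟪G i, (i : E) - x⟫
  have hΦc : Continuous Φ := by
    refine continuous_pi fun i => ?_
    exact continuous_const.inner (continuous_const.sub continuous_id)
  have hK : IsCompact (Φ '' convexHull ℝ (s : Set E)) :=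
    (s.finite_toSet.isCompact_convexHull (𝕜 := ℝ)).image hΦc
  have hKc : Convex ℝ (Φ '' convexHull ℝ (s : Set E)) := by
    rintro _ ⟨x, hx, rfl⟩ _ ⟨y, hy, rfl⟩ a b ha hb hab
    refine ⟨a • x + b • y, convex_convexHull ℝ _ hx hy ha hb hab, ?_⟩
    funext i
    simp only [Φ, Pi.add_apply, Pi.smul_apply, smul_eq_mul, inner_sub_right, inner_add_right,
      inner_smul_right]
    have : ⟪G i, (i : E)⟫ = (a + b) * ⟪G i, (i : E)⟫ := by rw [hab, one_mul]
    linear_combination this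
  have hdisj : Disjoint (Φ '' convexHull ℝ (s : Set E)) (Set.Ici (0 : s → ℝ)) := by
    rw [Set.disjoint_left]
    rintro _ ⟨x, hx, rfl⟩ h0
    obtain ⟨y, hy, hlt⟩ := hcon x hx
    have := h0 ⟨y, hy⟩
    simp only [Φ, Pi.zero_apply] at this
    linarith
  obtain ⟨φ, u, v, h1, huv, h2⟩ := geometric_hahn_banach_compact_closed hKc hK
    (convex_Ici (0 : s → ℝ)) isClosed_Ici hdisj
  have hv : v < 0 := by simpa using h2 0 (by simp)
  let l : s → ℝ := fun i => φ (Pi.single i 1)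
  have hφ : ∀ w : s → ℝ, φ w = ∑ i, l i * w i := by
    intro w
    have := LinearMap.pi_apply_eq_sum_univ φ.toLinearMap w
    simp only [ContinuousLinearMap.coe_coe] at this
    rw [this]
    refine Finset.sum_congr rfl fun i _ => ?_
    rw [smul_eq_mul, mul_comm]
    congr 2
    funext j
    simp [Pi.single_apply, eq_comm]
  have hl : ∀ i, 0 ≤ l i := by
    intro i
    by_contra hneg
    push Not at hneg
    have := h2 ((v / l i) • Pi.single i 1) (by
      have : 0 ≤ v / l i := div_nonneg_of_nonpos hv.le hneg.le
      refine Set.mem_Ici.2 (smul_nonneg this ?_)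
      exact Pi.single_nonneg.2 zero_le_one)
    rw [map_smul, smul_eq_mul] at this
    change v < v / l i * l i at this
    rw [div_mul_cancel₀ _ hneg.ne] at this
    exact lt_irrefl _ this
  have hS : 0 < ∑ i, l i := by
    refine lt_of_le_of_ne (Finset.sum_nonneg fun i _ => hl i) fun h => ?_
    have hz := (Finset.sum_eq_zero_iff_of_nonneg (fun i _ => hl i)).1 h.symm
    obtain ⟨y, hy⟩ := hs
    have := h1 (Φ y) ⟨y, subset_convexHull ℝ _ hy, rfl⟩
    rw [hφ, Finset.sum_eq_zero (fun i hi => by rw [hz i hi, zero_mul])] at this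
    linarith
  let x : E := Finset.univ.centerMass l (fun i : s => (i : E))
  have hx : x ∈ convexHull ℝ (s : Set E) :=
    Finset.centerMass_mem_convexHull _ (fun i _ => hl i) hS (fun i _ => i.2)
  have hSx : (∑ i, l i) • x = ∑ i, l i • (i : E) := by
    simp only [x, Finset.centerMass]
    rw [smul_smul, mul_inv_cancel₀ hS.ne', one_smul]
  have hneg : φ (Φ x) < 0 := by linarith [h1 (Φ x) ⟨x, hx, rfl⟩]
  have key : (∑ i, l i) * φ (Φ x) = ∑ i : s, ∑ j : s, l i * l j * ⟪G i, (i : E) - j⟫ := by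
    rw [hφ, Finset.mul_sum]
    refine Finset.sum_congr rfl fun i _ => ?_
    have : (∑ i, l i) * ⟪G i, (i : E) - x⟫ = ∑ j : s, l j * ⟪G i, (i : E) - j⟫ := by
      rw [← inner_smul_right, smul_sub, hSx, Finset.sum_smul, ← Finset.sum_sub_distrib, inner_sum]
      refine Finset.sum_congr rfl fun j _ => ?_
      rw [← smul_sub, inner_smul_right]
    simp only [Φ]
    rw [mul_left_comm, this, Finset.mul_sum]
    simp only [mul_assoc]
  have key2 : 0 ≤ ∑ i : s, ∑ j : s, l i * l j * ⟪G i, (i : E) - j⟫ := by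
    have hc : ∑ i : s, ∑ j : s, l i * l j * ⟪G i, (i : E) - j⟫
        = ∑ i : s, ∑ j : s, l j * l i * ⟪G j, (j : E) - i⟫ := Finset.sum_comm
    have : 0 ≤ ∑ i : s, ∑ j : s, l i * l j * ⟪G i, (i : E) - j⟫
        + ∑ i : s, ∑ j : s, l j * l i * ⟪G j, (j : E) - i⟫ := by
      simp only [← Finset.sum_add_distrib]
      refine Finset.sum_nonneg fun i _ => Finset.sum_nonneg fun j _ => ?_
      have h := mul_nonneg (mul_nonneg (hl i) (hl j)) (hG i j)
      have e : ⟪(i : E) - j, G i - G j⟫ = ⟪G i, (i : E) - j⟫ + ⟪G j, (j : E) - i⟫ := by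
        rw [real_inner_comm, inner_sub_left, ← neg_sub (j : E) i, inner_neg_right,
          inner_neg_right]
        ring
      rw [e] at h
      linarith
    linarith
  nlinarith

lemma strongly_monotone_zero {E : Type*} [NormedAddCommGroup E] [InnerProductSpace ℝ E]
    [ProperSpace E] (G : E → E) (hGc : Continuous G) (c : ℝ) (hc : 0 < c)
    (hG : ∀ x y, c * ‖x - y‖ ^ 2 ≤ ⟪x - y, G x - G y⟫) : ∃ x, G x = 0 := by
  classical
  let R : ℝ := ‖G 0‖ / c + 1
  have hR : 0 < R := by positivity
  have hmono : ∀ x y, 0 ≤ ⟪x - y, G x - G y⟫ := fun x y => le_trans (by positivity) (hG x y)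
  obtain ⟨x, hxR, hx⟩ := (isCompact_closedBall (0 : E) R).inter_iInter_nonempty
    (fun y : E => {x : E | y ∈ Metric.closedBall (0 : E) R → 0 ≤ ⟪G y, y - x⟫})
    (fun y => by
      by_cases hy : y ∈ Metric.closedBall (0 : E) R
      · simp only [hy, true_imp_iff]
        exact isClosed_le continuous_const
          (continuous_const.inner (continuous_const.sub continuous_id))
      · simp [hy])
    (fun u => by
      let s := insert 0 (u.filter (fun y => y ∈ Metric.closedBall (0 : E) R))
      obtain ⟨x, hx, hxs⟩ := finite_minty G hmono s (Finset.insert_nonempty _ _)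
      refine ⟨x, convexHull_min ?_ (convex_closedBall _ _) hx, ?_⟩
      · intro y hy
        simp only [s, Finset.coe_insert, Finset.coe_filter, Set.mem_insert_iff,
          Set.mem_ofPred_eq] at hy
        rcases hy with rfl | hy
        · exact Metric.mem_closedBall_self hR.le
        · exact hy.2
      · simp only [Set.mem_iInter]
        intro y hy hyR
        exact hxs y (Finset.mem_insert_of_mem (Finset.mem_filter.2 ⟨hy, hyR⟩)))
  simp only [Set.mem_iInter, Set.mem_ofPred_eq] at hx
  have hvar : ∀ z ∈ Metric.closedBall (0 : E) R, 0 ≤ ⟪G x, z - x⟫ := by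
    intro z hz
    have hcont : Continuous fun t : ℝ => ⟪G (x + t • (z - x)), z - x⟫ := by fun_prop
    have ht : Filter.Tendsto (fun t : ℝ => ⟪G (x + t • (z - x)), z - x⟫)
        (nhdsWithin 0 (Set.Ioi 0)) (nhds ⟪G x, z - x⟫) := by
      have := (hcont.tendsto 0).mono_left (nhdsWithin_le_nhds (s := Set.Ioi (0 : ℝ)))
      simpa using this
    refine ge_of_tendsto ht ?_
    filter_upwards [Ioo_mem_nhdsGT (zero_lt_one (α := ℝ))] with t ht
    have hm := (convex_closedBall (0 : E) R).add_smul_sub_mem hxR hz ⟨ht.1.le, ht.2.le⟩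
    have := hx _ hm
    rw [add_sub_cancel_left, inner_smul_right] at this
    exact nonneg_of_mul_nonneg_right this ht.1
  have hlt : ‖x‖ < R := by
    have h0 := hvar 0 (Metric.mem_closedBall_self hR.le)
    have h1 := hG x 0
    rw [zero_sub, inner_neg_right] at h0
    rw [sub_zero, inner_sub_right, real_inner_comm] at h1
    have h2 := neg_le_of_abs_le (abs_real_inner_le_norm x (G 0))
    have h3 : c * ‖x‖ ^ 2 ≤ ‖x‖ * ‖G 0‖ := by linarith
    by_contra hge
    push Not at hge
    have hxp : 0 < ‖x‖ := hR.trans_le hge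
    have h4 : c * ‖x‖ ≤ ‖G 0‖ := by
      refine le_of_mul_le_mul_left ?_ hxp
      linarith
    have h5 : c * R = ‖G 0‖ + c := by simp only [R]; field_simp
    nlinarith
  refine ⟨x, ?_⟩
  by_contra hne
  have hn : 0 < ‖G x‖ := norm_pos_iff.2 hne
  let t : ℝ := (R - ‖x‖) / ‖G x‖
  have htp : 0 < t := div_pos (by linarith) hn
  have := hvar (x - t • G x) (by
    rw [mem_closedBall_zero_iff]
    refine (norm_sub_le _ _).trans ?_
    rw [norm_smul, Real.norm_of_nonneg htp.le]
    simp only [t]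
    rw [div_mul_cancel₀ _ hn.ne']
    linarith)
  rw [sub_sub_cancel_left, inner_neg_right, inner_smul_right, real_inner_self_eq_norm_sq] at this
  have : 0 < t * ‖G x‖ ^ 2 := by positivity
  linarith


/-- **Unique solvability of the implicit Euler step.** Let `f` be continuous and satisfy
the one-sided Lipschitz condition with constant `L > 0`. Let `θ ∈ (0,1]`, `Δt > 0` with
`θΔt < 1/L`. Then `F x := x - θ (f x) Δt` is a bijection of `ℝⁿ` onto `ℝⁿ`;
equivalently, for every `b` there is a unique `X` with `X = b + θ (f X) Δt`. -/
theorem implicit_euler_step_bijective {n : ℕ}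
    (f : EuclideanSpace ℝ (Fin n) → EuclideanSpace ℝ (Fin n))
    (hf : Continuous f)
    (L : ℝ) (hL : 0 < L)
    (hosl : ∀ x y : EuclideanSpace ℝ (Fin n), ⟪x - y, f x - f y⟫ ≤ L * ‖x - y‖ ^ 2)
    (θ Δt : ℝ) (hθ : θ ∈ Set.Ioc (0 : ℝ) 1) (hΔt : 0 < Δt)
    (hstep : θ * Δt < 1 / L)
    (F : EuclideanSpace ℝ (Fin n) → EuclideanSpace ℝ (Fin n))
    (hF : ∀ x, F x = x - (θ * Δt) • f x) :
    Function.Bijective F ∧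
      ∀ b : EuclideanSpace ℝ (Fin n),
        ∃! X : EuclideanSpace ℝ (Fin n), X = b + (θ * Δt) • f X := by
  have hh : 0 < θ * Δt := mul_pos hθ.1 hΔt
  have hc : 0 < 1 - θ * Δt * L := by
    have := (lt_div_iff₀ hL).1 hstep
    linarith
  have hmono : ∀ x y, (1 - θ * Δt * L) * ‖x - y‖ ^ 2 ≤ ⟪x - y, F x - F y⟫ := by
    intro x y
    have e : F x - F y = (x - y) - (θ * Δt) • (f x - f y) := by
      rw [hF, hF, smul_sub]; abel
    rw [e, inner_sub_right, inner_smul_right, real_inner_self_eq_norm_sq]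
    have := mul_le_mul_of_nonneg_left (hosl x y) hh.le
    linarith
  have hFc : Continuous F := by
    rw [funext hF]
    fun_prop
  have hbij : Function.Bijective F := by
    constructor
    · intro x y hxy
      have := hmono x y
      rw [hxy, sub_self, inner_zero_right] at this
      have h2 : ‖x - y‖ ^ 2 ≤ 0 := by
        by_contra h
        push Not at h
        have := mul_pos hc h
        linarith
      have h3 : ‖x - y‖ = 0 := by
        have := sq_nonneg ‖x - y‖
        exact pow_eq_zero_iff (two_ne_zero) |>.1 (le_antisymm h2 this)
      exact sub_eq_zero.1 (norm_eq_zero.1 h3)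
    · intro b
      obtain ⟨x, hx⟩ := strongly_monotone_zero (fun x => F x - b) (by fun_prop) _ hc
        (fun x y => by simpa using hmono x y)
      exact ⟨x, sub_eq_zero.1 hx⟩
  refine ⟨hbij, fun b => ?_⟩
  have hiff : ∀ X, F X = b ↔ X = b + (θ * Δt) • f X := by
    intro X
    rw [hF, sub_eq_iff_eq_add]
  simpa only [hiff] using hbij.existsUnique b

end
end

section
/- (One-step inequality for the θ-EM scheme under the monotone condition) Let f : ℝ^n → ℝ^n and g : ℝ^n → ℝ^{n×d} satisfy the monotone condition: there exist constants α, β > 0 such that ⟨x, f(x)⟩ + (1/2)‖g(x)‖² ≤ α + β‖x‖² for all x ∈ ℝ^n. Let θ ∈ [1/2, 1], Δt > 0, and F(x) := x − θ f(x) Δt. If x, y ∈ ℝ^n and Δw ∈ ℝ^d satisfy F(y) = F(x) + f(x)Δt + g(x)Δw, then ‖F(y)‖² ≤ ‖F(x)‖² + 2αΔt + 2β‖x‖²Δt + ΔM, where ΔM := ‖g(x)Δw‖² − ‖g(x)‖²Δt + 2⟨F(x), g(x)Δw⟩ + 2⟨f(x)Δt, g(x)Δw⟩. -/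
open scoped RealInnerProductSpace

noncomputable section

/-- Frobenius norm of a real matrix. -/
def frob {n d : ℕ} (A : Matrix (Fin n) (Fin d) ℝ) : ℝ :=
  Real.sqrt (∑ i, ∑ j, (A i j) ^ 2)

/-- Matrix–vector product, landing in Euclidean space. -/
def mvec {n d : ℕ} (A : Matrix (Fin n) (Fin d) ℝ) (w : EuclideanSpace ℝ (Fin d)) :
    EuclideanSpace ℝ (Fin n) :=
  (EuclideanSpace.equiv (Fin n) ℝ).symm (A.mulVec (EuclideanSpace.equiv (Fin d) ℝ w))

/-- **One-step inequality for the θ-EM scheme under the monotone condition.**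
If `f, g` satisfy the monotone condition with constants `α, β > 0`, `θ ∈ [1/2, 1]`,
`Δt > 0`, `F x := x - θ (f x) Δt`, and `F y = F x + (f x) Δt + (g x) Δw`, then
`‖F y‖² ≤ ‖F x‖² + 2αΔt + 2β‖x‖²Δt + ΔM` where
`ΔM = ‖(g x) Δw‖² - ‖g x‖² Δt + 2⟪F x, (g x) Δw⟫ + 2⟪(f x) Δt, (g x) Δw⟫`. -/
theorem theta_EM_one_step_inequality {n d : ℕ}
    (f : EuclideanSpace ℝ (Fin n) → EuclideanSpace ℝ (Fin n))
    (g : EuclideanSpace ℝ (Fin n) → Matrix (Fin n) (Fin d) ℝ)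
    (α β : ℝ) (hα : 0 < α) (hβ : 0 < β)
    (hmono : ∀ x : EuclideanSpace ℝ (Fin n),
      ⟪x, f x⟫ + (1 / 2) * (frob (g x)) ^ 2 ≤ α + β * ‖x‖ ^ 2)
    (θ Δt : ℝ) (hθ : θ ∈ Set.Icc (1 / 2 : ℝ) 1) (hΔt : 0 < Δt)
    (F : EuclideanSpace ℝ (Fin n) → EuclideanSpace ℝ (Fin n))
    (hF : ∀ x, F x = x - (θ * Δt) • f x)
    (x y : EuclideanSpace ℝ (Fin n)) (Δw : EuclideanSpace ℝ (Fin d))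
    (hstep : F y = F x + Δt • f x + mvec (g x) Δw)
    (ΔM : ℝ)
    (hΔM : ΔM = ‖mvec (g x) Δw‖ ^ 2 - (frob (g x)) ^ 2 * Δt
        + 2 * ⟪F x, mvec (g x) Δw⟫ + 2 * ⟪Δt • f x, mvec (g x) Δw⟫) :
    ‖F y‖ ^ 2 ≤ ‖F x‖ ^ 2 + 2 * α * Δt + 2 * β * ‖x‖ ^ 2 * Δt + ΔM := by
  have h1 : ⟪F x, f x⟫ = ⟪x, f x⟫ - θ * Δt * ‖f x‖ ^ 2 := by
    rw [hF x, inner_sub_left, real_inner_smul_left, real_inner_self_eq_norm_sq]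
  have h2 : ‖Δt • f x‖ ^ 2 = Δt ^ 2 * ‖f x‖ ^ 2 := by
    rw [norm_smul, mul_pow, Real.norm_eq_abs, sq_abs]
  have h3 := mul_le_mul_of_nonneg_left (hmono x) hΔt.le
  have h4 : 0 ≤ (2 * θ - 1) * (Δt ^ 2 * ‖f x‖ ^ 2) :=
    mul_nonneg (by linarith [hθ.1]) (by positivity)
  rw [hstep, hΔM, norm_add_sq_real, norm_add_sq_real, inner_add_left, h2,
    real_inner_smul_right, h1]
  linarith

end
end

section
/- (Lower bound for FBEM iterates) Let f : ℝ^n → ℝ^n, g : ℝ^n → ℝ^{n×d}, θ ∈ [0,1], Δt > 0, F(x) := x − θ f(x) Δt, and let (Δw_k)_{k∈ℕ} be any sequence in ℝ^d. Suppose (X_k) and (X̂_k) in ℝ^n satisfy X̂_0 = X_0, X_{k+1} = X_k + θ f(X_{k+1})Δt + (1−θ) f(X_k)Δt + g(X_k)Δw_k, and X̂_{k+1} = X̂_k + f(X_k)Δt + g(X_k)Δw_k for all k ∈ ℕ. Then for every N ∈ ℕ, ‖X̂_N‖² ≥ (1/2)‖F(X_N)‖² − ‖θ f(X_0) Δt‖².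 -/
open scoped RealInnerProductSpace

noncomputable section

/-- **Lower bound for FBEM iterates.** If `(X k)` solves the θ-EM recursion and
`(X̂ k)` solves the FBEM recursion with `X̂ 0 = X 0`, and `F x := x - θ (f x) Δt`,
then for every `N`, `‖X̂ N‖² ≥ (1/2) ‖F (X N)‖² - ‖θ (f (X 0)) Δt‖²`. -/
theorem FBEM_lower_bound {n d : ℕ}
    (f : EuclideanSpace ℝ (Fin n) → EuclideanSpace ℝ (Fin n))
    (g : EuclideanSpace ℝ (Fin n) → Matrix (Fin n) (Fin d) ℝ)
    (θ Δt : ℝ) (hθ : θ ∈ Set.Icc (0 : ℝ) 1) (hΔt : 0 < Δt)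
    (F : EuclideanSpace ℝ (Fin n) → EuclideanSpace ℝ (Fin n))
    (hF : ∀ x, F x = x - (θ * Δt) • f x)
    (Δw : ℕ → EuclideanSpace ℝ (Fin d))
    (X Xhat : ℕ → EuclideanSpace ℝ (Fin n))
    (h0 : Xhat 0 = X 0)
    (hX : ∀ k : ℕ, X (k + 1) = X k + (θ * Δt) • f (X (k + 1))
        + ((1 - θ) * Δt) • f (X k) + mvec (g (X k)) (Δw k))
    (hXhat : ∀ k : ℕ, Xhat (k + 1) = Xhat k + Δt • f (X k) + mvec (g (X k)) (Δw k)) :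
    ∀ N : ℕ, (1 / 2) * ‖F (X N)‖ ^ 2 - ‖(θ * Δt) • f (X 0)‖ ^ 2 ≤ ‖Xhat N‖ ^ 2 := by
  have key : ∀ N : ℕ, F (X N) = Xhat N - (θ * Δt) • f (X 0) := by
    intro N
    induction N with
    | zero => rw [hF, h0]
    | succ k ih =>
      have h1 : X (k + 1) - (θ * Δt) • f (X (k + 1))
          = X k + ((1 - θ) * Δt) • f (X k) + mvec (g (X k)) (Δw k) := by
        rw [sub_eq_iff_eq_add]
        nth_rewrite 1 [hX k]
        abel
      rw [hF] at ih
      have h2 : Xhat k = X k - (θ * Δt) • f (X k) + (θ * Δt) • f (X 0) := by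
        rw [ih]; abel
      rw [hF, h1, hXhat, h2]
      module
  intro N
  rw [key N]
  have h := norm_sub_le (Xhat N) ((θ * Δt) • f (X 0))
  have hn := norm_nonneg (Xhat N - (θ * Δt) • f (X 0))
  have hs := pow_le_pow_left₀ hn h 2
  nlinarith [sq_nonneg (‖Xhat N‖ - ‖(θ * Δt) • f (X 0)‖)]

end
end

section
/- (One-step inequality for the split-drift θ-EM scheme) Let f₁, f₂ : ℝ^n → ℝ^n, f := f₁ + f₂, g : ℝ^n → ℝ^{n×d}, θ ∈ [0,1], Δt > 0, and H(x) := x − θ f₁(x) Δt. Assume there exist constants α, β > 0 such that for all x ∈ ℝ^n: ⟨x, f(x)⟩ + (1/2)‖g(x)‖² + [(1 − θ)⟨f₁(x), f₂(x)⟩ + (1/2)‖f₂(x)‖² + (1/2)(1 − 2θ)‖f₁(x)‖²]Δt ≤ α + β‖x‖². If x, y ∈ ℝ^n and Δw ∈ ℝ^d satisfy H(y) = H(x) + f(x)Δt + g(x)Δw, then ‖H(y)‖² ≤ ‖H(x)‖² + 2αΔt + 2β‖x‖²Δt + ΔM, where ΔM := ‖g(x)Δw‖² − ‖g(x)‖²Δt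 + 2⟨H(x), g(x)Δw⟩ + 2⟨f(x)Δt, g(x)Δw⟩. -/
open scoped RealInnerProductSpace

noncomputable section

/-- **One-step inequality for the split-drift θ-EM scheme.** With `f = f₁ + f₂`,
`H x := x - θ (f₁ x) Δt`, if there are `α, β > 0` with
`⟪x, f x⟫ + (1/2)‖g x‖² + [(1-θ)⟪f₁ x, f₂ x⟫ + (1/2)‖f₂ x‖² + (1/2)(1-2θ)‖f₁ x‖²] Δt
  ≤ α + β‖x‖²` for all `x`, and `H y = H x + (f x) Δt + (g x) Δw`, then
`‖H y‖² ≤ ‖H x‖² + 2αΔt + 2β‖x‖²Δt + ΔM` where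
`ΔM = ‖(g x) Δw‖² - ‖g x‖² Δt + 2⟪H x, (g x) Δw⟫ + 2⟪(f x) Δt, (g x) Δw⟫`. -/
theorem split_drift_theta_EM_one_step_inequality {n d : ℕ}
    (f₁ f₂ f : EuclideanSpace ℝ (Fin n) → EuclideanSpace ℝ (Fin n))
    (hf : ∀ x, f x = f₁ x + f₂ x)
    (g : EuclideanSpace ℝ (Fin n) → Matrix (Fin n) (Fin d) ℝ)
    (θ Δt : ℝ) (hθ : θ ∈ Set.Icc (0 : ℝ) 1) (hΔt : 0 < Δt)
    (H : EuclideanSpace ℝ (Fin n) → EuclideanSpace ℝ (Fin n))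
    (hH : ∀ x, H x = x - (θ * Δt) • f₁ x)
    (α β : ℝ) (hα : 0 < α) (hβ : 0 < β)
    (hmono : ∀ x : EuclideanSpace ℝ (Fin n),
      ⟪x, f x⟫ + (1 / 2) * (frob (g x)) ^ 2
        + ((1 - θ) * ⟪f₁ x, f₂ x⟫ + (1 / 2) * ‖f₂ x‖ ^ 2
            + (1 / 2) * (1 - 2 * θ) * ‖f₁ x‖ ^ 2) * Δt
        ≤ α + β * ‖x‖ ^ 2)
    (x y : EuclideanSpace ℝ (Fin n)) (Δw : EuclideanSpace ℝ (Fin d))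
    (hstep : H y = H x + Δt • f x + mvec (g x) Δw)
    (ΔM : ℝ)
    (hΔM : ΔM = ‖mvec (g x) Δw‖ ^ 2 - (frob (g x)) ^ 2 * Δt
        + 2 * ⟪H x, mvec (g x) Δw⟫ + 2 * ⟪Δt • f x, mvec (g x) Δw⟫) :
    ‖H y‖ ^ 2 ≤ ‖H x‖ ^ 2 + 2 * α * Δt + 2 * β * ‖x‖ ^ 2 * Δt + ΔM := by
  have key : ‖H y‖ ^ 2 = ‖H x‖ ^ 2 + 2 * ⟪H x, Δt • f x⟫ + ‖Δt • f x‖ ^ 2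
      + ‖mvec (g x) Δw‖ ^ 2
      + 2 * ⟪H x, mvec (g x) Δw⟫ + 2 * ⟪Δt • f x, mvec (g x) Δw⟫ := by
    rw [hstep, norm_add_sq_real, norm_add_sq_real, inner_add_left]
    ring
  have h1 : ⟪H x, Δt • f x⟫ = Δt * (⟪x, f x⟫
      - θ * Δt * (‖f₁ x‖ ^ 2 + ⟪f₁ x, f₂ x⟫)) := by
    rw [hH, inner_smul_right, inner_sub_left, inner_smul_left]
    conv_lhs => rw [hf x, inner_add_right (f₁ x), real_inner_self_eq_norm_sq]
    rw [hf x]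
    simp
  have h2 : ‖Δt • f x‖ ^ 2 = Δt ^ 2 * (‖f₁ x‖ ^ 2 + 2 * ⟪f₁ x, f₂ x⟫ + ‖f₂ x‖ ^ 2) := by
    rw [norm_smul, mul_pow, hf, norm_add_sq_real]
    simp
  have h3 := mul_le_mul_of_nonneg_left (hmono x) (by positivity : 0 ≤ 2 * Δt)
  rw [key, hΔM, h1, h2]
  linarith

end
end
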